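/- Let n ≥ 1. (i) For every r with 1 ≤ r ≤ n: there exist nonzero isotropic linear forms ℓ_1,…,ℓ_r in ℂ[x_0,…,x_n] such that the ℂ-vector subspace of quadratic forms spanned by all products ℓ_j·m, where 1 ≤ j ≤ r and m ranges over the linear forms orthogonal to ℓ_j, has dimension exactly r·n − C(r−1, 2); moreover, for EVERY choice of r isotropic linear forms ℓ_1,…,ℓ_r the dimension of this span is at most r·n − C(r−1, 2). (ii) There exist nonzero isotropic linear forms ℓ_1,…,ℓ_{n+1} such that the span of all products ℓ_j·m (1 ≤ j ≤ n+1, m orthogonal to ℓ_j) is the full space of harmonic quadratic forms, of dimension C(n+2,2) − 1. -/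

import Mathlib

open MvPolynomial

/-- The linear form with coefficient vector `a`. -/
noncomputable def lin {n : ℕ} (a : Fin n → ℂ) : MvPolynomial (Fin n) ℂ :=
  ∑ i, MvPolynomial.C (a i) * MvPolynomial.X i

/-- The Laplace operator `Δ = ∑ ∂²/∂xᵢ²`. -/
noncomputable def lap {n : ℕ} (p : MvPolynomial (Fin n) ℂ) : MvPolynomial (Fin n) ℂ :=
  ∑ i, MvPolynomial.pderiv i (MvPolynomial.pderiv i p)

/-- A coefficient vector (linear form) is isotropic if `∑ aᵢ² = 0`. -/
def Isotropic {n : ℕ} (a : Fin n → ℂ) : Prop :=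
  ∑ i, (a i) ^ 2 = 0

/-- Isotropic rank: least `r` such that `h` is a sum of `r` `d`-th powers of
isotropic linear forms. -/
noncomputable def irk {n : ℕ} (d : ℕ) (h : MvPolynomial (Fin n) ℂ) : ℕ :=
  sInf {r : ℕ | ∃ ℓ : Fin r → (Fin n → ℂ),
    (∀ j, Isotropic (ℓ j)) ∧ h = ∑ j, (lin (ℓ j)) ^ d}

/-- Waring rank: least `r` such that `h` is a sum of `r` `d`-th powers of
linear forms. -/
noncomputable def wrk {n : ℕ} (d : ℕ) (h : MvPolynomial (Fin n) ℂ) : ℕ :=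
  sInf {r : ℕ | ∃ ℓ : Fin r → (Fin n → ℂ), h = ∑ j, (lin (ℓ j)) ^ d}

/-- `lin` as a linear map. -/
noncomputable def linL (n : ℕ) : (Fin n → ℂ) →ₗ[ℂ] MvPolynomial (Fin n) ℂ where
  toFun := lin
  map_add' a b := by simp [lin, add_mul, Finset.sum_add_distrib]
  map_smul' c a := by simp [lin, Finset.smul_sum, MvPolynomial.smul_eq_C_mul, mul_assoc]

@[simp] lemma linL_apply {n : ℕ} (a : Fin n → ℂ) : linL n a = lin a := rfl

lemma coeff_lin {n : ℕ} (a : Fin n → ℂ) (i : Fin n) :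
    MvPolynomial.coeff (Finsupp.single i 1) (lin a) = a i := by
  classical
  simp [lin, MvPolynomial.coeff_sum, MvPolynomial.coeff_C_mul, MvPolynomial.coeff_X,
    Finsupp.single_left_inj]

lemma linL_injective (n : ℕ) : Function.Injective (linL n) := by
  intro a b h
  funext i
  have := congrArg (MvPolynomial.coeff (Finsupp.single i 1)) h
  simpa [coeff_lin] using this

lemma lin_ne_zero {n : ℕ} {a : Fin n → ℂ} (h : a ≠ 0) : lin a ≠ 0 := by
  intro h0
  exact h (linL_injective n (by rw [map_zero]; exact h0))

/-- `lap` as a linear map. -/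
noncomputable def lapL (n : ℕ) : MvPolynomial (Fin n) ℂ →ₗ[ℂ] MvPolynomial (Fin n) ℂ where
  toFun := lap
  map_add' a b := by simp [lap, Finset.sum_add_distrib]
  map_smul' c a := by simp [lap, Finset.smul_sum]

@[simp] lemma lapL_apply {n : ℕ} (p : MvPolynomial (Fin n) ℂ) : lapL n p = lap p := rfl

lemma pderiv_lin {n : ℕ} (a : Fin n → ℂ) (i : Fin n) :
    MvPolynomial.pderiv i (lin a) = MvPolynomial.C (a i) := by
  classical
  simp [lin, MvPolynomial.pderiv_X, Pi.single_apply, Derivation.leibniz]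

lemma lap_mul {n : ℕ} (a b : Fin n → ℂ) :
    lap (lin a * lin b) = MvPolynomial.C (2 * ∑ i, a i * b i) := by
  simp only [lap, Derivation.leibniz, pderiv_lin, map_add, smul_eq_mul, MvPolynomial.pderiv_C,
    mul_zero, zero_add, add_zero, map_mul, map_sum, Finset.mul_sum]
  refine Finset.sum_congr rfl fun i _ => ?_
  rw [map_ofNat]
  ring

/-- The span of products of forms in `L` with all linear forms. -/
noncomputable def LM {n : ℕ} (L : Submodule ℂ (Fin n → ℂ)) :
    Submodule ℂ (MvPolynomial (Fin n) ℂ) :=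
  L.map (linL n) * (⊤ : Submodule ℂ (Fin n → ℂ)).map (linL n)

instance {n : ℕ} (L : Submodule ℂ (Fin n → ℂ)) : Module.Finite ℂ (LM L) := by
  rw [Module.Finite.iff_fg]
  exact Submodule.FG.mul ((IsNoetherian.noetherian L).map _) (Module.Finite.fg_top.map _)

lemma mem_LM {n : ℕ} {L : Submodule ℂ (Fin n → ℂ)} {a : Fin n → ℂ} (h : a ∈ L)
    (m : Fin n → ℂ) : lin a * lin m ∈ LM L :=
  Submodule.mul_mem_mul ⟨a, h, rfl⟩ ⟨m, trivial, rfl⟩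

lemma LM_le {n : ℕ} {L : Submodule ℂ (Fin n → ℂ)} {P : Submodule ℂ (MvPolynomial (Fin n) ℂ)} :
    LM L ≤ P ↔ ∀ a ∈ L, ∀ m, lin a * lin m ∈ P := by
  rw [LM, Submodule.mul_le]
  constructor
  · intro h a ha m
    exact h _ ⟨a, ha, rfl⟩ _ ⟨m, trivial, rfl⟩
  · rintro h _ ⟨a, ha, rfl⟩ _ ⟨m, -, rfl⟩
    exact h a ha m

/-- Multiplication of linear forms by a fixed linear form. -/
noncomputable def mulV {n : ℕ} (v : Fin n → ℂ) : (Fin n → ℂ) →ₗ[ℂ] MvPolynomial (Fin n) ℂ :=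
  (LinearMap.mulLeft ℂ (lin v)).comp (linL n)

@[simp] lemma mulV_apply {n : ℕ} (v m : Fin n → ℂ) : mulV v m = lin v * lin m := rfl

lemma mulV_injective {n : ℕ} {v : Fin n → ℂ} (hv : v ≠ 0) : Function.Injective (mulV v) := by
  intro a b h
  simp only [mulV_apply] at h
  exact linL_injective n (mul_left_cancel₀ (lin_ne_zero hv) h)

lemma finrank_mulV {n : ℕ} {v : Fin n → ℂ} (hv : v ≠ 0) (L : Submodule ℂ (Fin n → ℂ)) :
    Module.finrank ℂ (L.map (mulV v)) = Module.finrank ℂ L :=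
  (Submodule.equivMapOfInjective _ (mulV_injective hv) L).finrank_eq.symm

lemma LM_step {n : ℕ} (L : Submodule ℂ (Fin n → ℂ)) {v : Fin n → ℂ} (hv : v ∉ L) :
    Module.finrank ℂ (LM (L ⊔ Submodule.span ℂ {v})) + Module.finrank ℂ L
      ≤ Module.finrank ℂ (LM L) + n := by
  have hv0 : v ≠ 0 := fun h => hv (h ▸ L.zero_mem)
  have h1 : LM (L ⊔ Submodule.span ℂ {v}) ≤ LM L ⊔ (⊤ : Submodule ℂ (Fin n → ℂ)).map (mulV v) := by
    rw [LM_le]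
    intro a ha m
    obtain ⟨x, hx, y, hy, rfl⟩ := Submodule.mem_sup.1 ha
    obtain ⟨c, rfl⟩ := Submodule.mem_span_singleton.1 hy
    have : lin (x + c • v) * lin m = lin x * lin m + mulV v (c • m) := by
      simp only [mulV_apply, ← linL_apply, map_add, map_smul, add_mul, smul_mul_assoc,
        mul_smul_comm]
    rw [this]
    exact Submodule.add_mem_sup (mem_LM hx m) ⟨_, trivial, rfl⟩
  have h2 : L.map (mulV v) ≤ LM L ⊓ (⊤ : Submodule ℂ (Fin n → ℂ)).map (mulV v) := by
    rintro _ ⟨m, hm, rfl⟩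
    refine ⟨?_, ⟨m, trivial, rfl⟩⟩
    have := mem_LM hm v
    rwa [mul_comm] at this
  have h3 := Submodule.finrank_sup_add_finrank_inf_eq (LM L)
    ((⊤ : Submodule ℂ (Fin n → ℂ)).map (mulV v))
  have h4 := Submodule.finrank_mono h1
  have h5 := Submodule.finrank_mono h2
  rw [finrank_mulV hv0] at h3 h5
  simp only [finrank_top, Module.finrank_fin_fun] at h3
  omega

lemma LM_upper {n : ℕ} (s : ℕ) : ∀ L : Submodule ℂ (Fin n → ℂ), Module.finrank ℂ L = s →
    Module.finrank ℂ (LM L) + s.choose 2 ≤ s * n := by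
  induction s with
  | zero =>
    intro L hL
    have : L = ⊥ := Submodule.finrank_eq_zero.1 hL
    subst this
    rw [LM, Submodule.map_bot, Submodule.bot_mul]
    simp
  | succ s ih =>
    intro L hL
    obtain ⟨L', hL', hs⟩ : ∃ L' : Submodule ℂ (Fin n → ℂ), Module.finrank ℂ L' = s ∧ L' ≤ L := by
      obtain ⟨f, hf⟩ := exists_linearIndependent_of_le_finrank (R := ℂ) (M := L) (n := s) (by omega)
      have hf' : LinearIndependent ℂ (fun i => (f i : Fin n → ℂ)) :=
        hf.map' L.subtype (Submodule.ker_subtype L)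
      refine ⟨Submodule.span ℂ (Set.range fun i => (f i : Fin n → ℂ)), ?_, ?_⟩
      · rw [finrank_span_eq_card hf', Fintype.card_fin]
      · rw [Submodule.span_le]
        rintro _ ⟨i, rfl⟩
        exact (f i).2
    obtain ⟨v, hvL, hv⟩ : ∃ v ∈ L, v ∉ L' := by
      by_contra! h
      have := Submodule.finrank_mono (h : L ≤ L')
      omega
    have he : L' ⊔ Submodule.span ℂ {v} = L := by
      refine Submodule.eq_of_le_of_finrank_eq
        (sup_le hs (by simpa [Submodule.span_singleton_le_iff_mem] using hvL)) ?_
      rw [Submodule.finrank_sup_span_singleton hv]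
      omega
    have h1 := LM_step L' hv
    have h2 := ih L' hL'
    rw [he] at h1
    have : (s + 1).choose 2 = s + s.choose 2 := by
      rw [Nat.choose_succ_succ' s 1, Nat.choose_one_right]
    rw [add_mul]
    omega

lemma map_top_linL (n : ℕ) : (⊤ : Submodule ℂ (Fin n → ℂ)).map (linL n)
    = homogeneousSubmodule (Fin n) ℂ 1 := by
  classical
  rw [homogeneousSubmodule_one_eq_span_X]
  apply le_antisymm
  · rintro _ ⟨a, -, rfl⟩
    rw [linL_apply, lin]
    refine Submodule.sum_mem _ fun i _ => ?_
    rw [← MvPolynomial.smul_eq_C_mul]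
    exact Submodule.smul_mem _ _ (Submodule.subset_span ⟨i, rfl⟩)
  · rw [Submodule.span_le]
    rintro _ ⟨i, rfl⟩
    refine ⟨Pi.single i 1, trivial, ?_⟩
    simp [lin, Pi.single_apply]

lemma LM_top (n : ℕ) : LM (⊤ : Submodule ℂ (Fin n → ℂ)) = homogeneousSubmodule (Fin n) ℂ 2 := by
  rw [LM, map_top_linL, ← pow_two, homogeneousSubmodule_one_pow]

lemma finrank_hom2 (n : ℕ) :
    Module.finrank ℂ (homogeneousSubmodule (Fin n) ℂ 2) = (n + 1).choose 2 := by
  classical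
  rw [homogeneousSubmodule_eq_finsupp_supported]
  have e1 := (AddMonoidAlgebra.supportedEquivFinsupp (R := ℂ) (S := ℂ)
    {d : Fin n →₀ ℕ | d.degree = 2}).finrank_eq
  have e : {d : Fin n →₀ ℕ | d.degree = 2} ≃ Sym (Fin n) 2 :=
    (Sym.equivNatSum (Fin n) 2).symm
  have e2 := (Finsupp.domLCongr (R := ℂ) (M := ℂ) e).finrank_eq
  refine (e1.trans e2).trans ?_
  rw [Module.finrank_finsupp_self, Sym.card_sym_eq_choose]
  simp

lemma LM_lower {n : ℕ} (k : ℕ) : ∀ L : Submodule ℂ (Fin n → ℂ), Module.finrank ℂ L + k = n →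
    Module.finrank ℂ L * n ≤ Module.finrank ℂ (LM L) + (Module.finrank ℂ L).choose 2 := by
  induction k with
  | zero =>
    intro L hL
    have : L = ⊤ := Submodule.eq_top_of_finrank_eq (by simpa using hL)
    subst this
    rw [LM_top, finrank_hom2]
    simp only [finrank_top, Module.finrank_fin_fun]
    have h := Nat.choose_succ_succ' n 1
    rw [Nat.choose_one_right] at h
    have h2 : n.choose 2 * 2 = n * (n - 1) := by
      rw [Nat.choose_two_right]
      exact Nat.div_mul_cancel (Nat.even_mul_pred_self n).two_dvd
    rw [h]
    rcases n with _ | n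
    · simp
    · simp only [Nat.add_sub_cancel] at h2
      norm_num at *
      nlinarith
  | succ k ih =>
    intro L hL
    obtain ⟨v, hv⟩ : ∃ v, v ∉ L := by
      by_contra! h
      have : L = ⊤ := by ext; simp [h]
      subst this
      simp at hL
    have h1 := LM_step L hv
    have h3 := Submodule.finrank_sup_span_singleton hv
    have h2 := ih (L ⊔ Submodule.span ℂ {v}) (by omega)
    rw [h3] at h2
    have : (Module.finrank ℂ L + 1).choose 2
        = Module.finrank ℂ L + (Module.finrank ℂ L).choose 2 := by
      rw [Nat.choose_succ_succ' _ 1, Nat.choose_one_right]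
    rw [add_mul] at h2
    omega

/-- The span of the tangent spaces. -/
noncomputable def TS {n r : ℕ} (ℓ : Fin r → (Fin n → ℂ)) :
    Submodule ℂ (MvPolynomial (Fin n) ℂ) :=
  Submodule.span ℂ {p : MvPolynomial (Fin n) ℂ | ∃ (j : Fin r) (m : Fin n → ℂ),
              (∑ i, ℓ j i * m i = 0) ∧ p = lin (ℓ j) * lin m}

lemma TS_le {n r : ℕ} (ℓ : Fin r → (Fin n → ℂ)) :
    TS ℓ ≤ LM (Submodule.span ℂ (Set.range ℓ)) := by
  rw [TS, Submodule.span_le]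
  rintro _ ⟨j, m, -, rfl⟩
  exact mem_LM (Submodule.subset_span (Set.mem_range_self j)) m

lemma TS_le_ker {n r : ℕ} (ℓ : Fin r → (Fin n → ℂ)) :
    TS ℓ ≤ LinearMap.ker (lapL n) := by
  rw [TS, Submodule.span_le]
  rintro _ ⟨j, m, h, rfl⟩
  simp [lap_mul, h]

lemma LM_not_le_ker {n : ℕ} {L : Submodule ℂ (Fin n → ℂ)} (hL : L ≠ ⊥) :
    ¬ LM L ≤ LinearMap.ker (lapL n) := by
  classical
  intro h
  obtain ⟨a, ha, ha0⟩ := Submodule.exists_mem_ne_zero_of_ne_bot hL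
  obtain ⟨i, hi⟩ := Function.ne_iff.1 ha0
  have := h (mem_LM ha (Pi.single i 1))
  simp [lap_mul, Pi.single_apply] at this
  exact hi this

lemma TS_upper {n r : ℕ} (ℓ : Fin r → (Fin n → ℂ))
    (h : Submodule.span ℂ (Set.range ℓ) ≠ ⊥) :
    Module.finrank ℂ (TS ℓ) + 1 ≤ Module.finrank ℂ (LM (Submodule.span ℂ (Set.range ℓ))) := by
  refine Submodule.finrank_lt_finrank_of_lt (lt_of_le_of_ne (TS_le ℓ) ?_)
  intro he
  exact LM_not_le_ker h (he ▸ TS_le_ker ℓ)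

instance {n r : ℕ} (ℓ : Fin r → (Fin n → ℂ)) : Module.Finite ℂ (TS ℓ) :=
  Submodule.finiteDimensional_of_le (TS_le ℓ)

/-- One-step reduction: modulo the tangent space at `ℓ j`, the form `ℓ j * m` is a multiple of
`ℓ j * u` where `u` is not orthogonal to `ℓ j`. -/
lemma TS_reduce {n r : ℕ} (ℓ : Fin r → (Fin n → ℂ)) (j : Fin r) (u m : Fin n → ℂ)
    (hu : ∑ i, ℓ j i * u i ≠ 0) :
    ∃ c : ℂ, lin (ℓ j) * lin m - c • (lin (ℓ j) * lin u) ∈ TS ℓ := by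
  refine ⟨(∑ i, ℓ j i * m i) / (∑ i, ℓ j i * u i), Submodule.subset_span
    ⟨j, m - ((∑ i, ℓ j i * m i) / (∑ i, ℓ j i * u i)) • u, ?_, ?_⟩⟩
  · have : ∀ c : ℂ, ∑ i, ℓ j i * (m - c • u) i = ∑ i, ℓ j i * m i - c * ∑ i, ℓ j i * u i := by
      intro c
      rw [Finset.mul_sum, ← Finset.sum_sub_distrib]
      refine Finset.sum_congr rfl fun i _ => ?_
      simp only [Pi.sub_apply, Pi.smul_apply, smul_eq_mul]
      ring
    rw [this, div_mul_cancel₀ _ hu, sub_self]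
  · simp only [← linL_apply, map_sub, map_smul, mul_sub, mul_smul_comm]

lemma TS_lower {n r : ℕ} (ℓ : Fin r → (Fin n → ℂ)) (j₀ : Fin r) (h0 : ℓ j₀ ≠ 0)
    (h : ∀ j, j ≠ j₀ → ∑ i, ℓ j i * ℓ j₀ i ≠ 0) :
    Module.finrank ℂ (LM (Submodule.span ℂ (Set.range ℓ))) ≤ Module.finrank ℂ (TS ℓ) + 1 := by
  classical
  obtain ⟨k, hk⟩ := Function.ne_iff.1 h0
  set q := lin (ℓ j₀) * lin (Pi.single k 1) with hq
  have h00 : ∀ m, lin (ℓ j₀) * lin m ∈ TS ℓ ⊔ Submodule.span ℂ {q} := by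
    intro m
    obtain ⟨c, hc⟩ := TS_reduce ℓ j₀ (Pi.single k 1) m (by simpa [Pi.single_apply] using hk)
    rw [← sub_add_cancel (lin (ℓ j₀) * lin m) (c • q)]
    exact Submodule.add_mem_sup hc (Submodule.smul_mem _ _ (Submodule.mem_span_singleton_self _))
  have h1 : LM (Submodule.span ℂ (Set.range ℓ)) ≤ TS ℓ ⊔ Submodule.span ℂ {q} := by
    rw [LM_le]
    intro a ha m
    induction ha using Submodule.span_induction with
    | mem x hx =>
      obtain ⟨j, rfl⟩ := hx
      by_cases hj : j = j₀
      · subst hj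
        exact h00 m
      · obtain ⟨c, hc⟩ := TS_reduce ℓ j (ℓ j₀) m (h j hj)
        rw [← sub_add_cancel (lin (ℓ j) * lin m) (c • (lin (ℓ j) * lin (ℓ j₀)))]
        refine Submodule.add_mem _ (Submodule.mem_sup_left hc) (Submodule.smul_mem _ _ ?_)
        rw [mul_comm]
        exact h00 _
    | zero => simp [← linL_apply]
    | add x y _ _ hx hy =>
      rw [← linL_apply, map_add, add_mul]
      exact Submodule.add_mem _ hx hy
    | smul c x _ hx =>
      rw [← linL_apply, map_smul, smul_mul_assoc]
      exact Submodule.smul_mem _ _ hx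
  have h2 := Submodule.finrank_mono h1
  have h3 := Submodule.finrank_add_le_finrank_add_finrank (TS ℓ) (Submodule.span ℂ {q})
  have h4 : Module.finrank ℂ (Submodule.span ℂ {q}) ≤ 1 := by
    simpa using finrank_span_le_card (R := ℂ) ({q} : Set (MvPolynomial (Fin n) ℂ))
  omega

/-- The special isotropic family. -/
noncomputable def fam (n : ℕ) (j : Fin (n + 2)) : Fin (n + 2) → ℂ :=
  if j = 0 then Pi.single 0 1 + Pi.single 1 Complex.I
  else Pi.single 0 1 - Pi.single j Complex.I

lemma fam_isotropic (n : ℕ) (j : Fin (n + 2)) : Isotropic (fam n j) := by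
  have key : ∀ (k : Fin (n + 2)) (c : ℂ), k ≠ 0 → c ^ 2 = -1 →
      Isotropic (Pi.single 0 1 + Pi.single k c : Fin (n + 2) → ℂ) := by
    intro k c hk hc
    unfold Isotropic
    have : ∀ i, ((Pi.single 0 1 + Pi.single k c : Fin (n + 2) → ℂ) i) ^ 2
        = (if i = 0 then 1 else 0) + (if i = k then c ^ 2 else 0) := by
      intro i
      by_cases h1 : i = 0
      · subst h1; simp [Pi.single_apply, hk.symm]
      · by_cases h2 : i = k <;> simp [Pi.single_apply, h1, h2]
        subst h2; simp [h1]
    rw [Finset.sum_congr rfl fun i _ => this i]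
    simp [Finset.sum_add_distrib, hc]
  unfold fam
  split_ifs with h
  · exact key 1 _ (by simp) (by simp)
  · have := key j (-Complex.I) h (by simp)
    rwa [Pi.single_neg, ← sub_eq_add_neg] at this

lemma fam_pair (n : ℕ) (j : Fin (n + 2)) (hj : j ≠ 0) :
    ∑ i, fam n j i * fam n 0 i ≠ 0 := by
  have h : ∑ i, fam n j i * fam n 0 i = if j = 1 then 2 else 1 := by
    simp only [fam, hj, if_true, if_false, Pi.sub_apply, Pi.add_apply, mul_add, sub_mul,
      Finset.sum_add_distrib, Finset.sum_sub_distrib, Pi.single_apply, mul_ite, mul_zero,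
      Finset.sum_ite_eq', Finset.sum_ite_eq, Finset.mem_univ, mul_one]
    by_cases h1 : j = 1
    · subst h1; simp; norm_num
    · simp [h1, Ne.symm h1, hj.symm]
  rw [h]
  split_ifs <;> norm_num

lemma fam_span (n : ℕ) : Submodule.span ℂ (Set.range (fam n)) = ⊤ := by
  have hmem : ∀ j, fam n j ∈ Submodule.span ℂ (Set.range (fam n)) :=
    fun j => Submodule.subset_span ⟨j, rfl⟩
  have h0 : (Pi.single 0 1 : Fin (n + 2) → ℂ) ∈ Submodule.span ℂ (Set.range (fam n)) := by
    have : (Pi.single 0 1 : Fin (n + 2) → ℂ) = (2⁻¹ : ℂ) • (fam n 0 + fam n 1) := by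
      simp only [fam, if_true, one_ne_zero, if_false]
      ext i
      simp
      ring
    rw [this]
    exact Submodule.smul_mem _ _ (Submodule.add_mem _ (hmem 0) (hmem 1))
  have hj : ∀ j, (Pi.single j 1 : Fin (n + 2) → ℂ) ∈ Submodule.span ℂ (Set.range (fam n)) := by
    intro j
    by_cases h : j = 0
    · subst h; exact h0
    · have : (Pi.single j 1 : Fin (n + 2) → ℂ) = Complex.I • (fam n j - Pi.single 0 1) := by
        simp only [fam, h, if_false]
        ext i
        by_cases hi : i = j <;> simp [Pi.single_apply, hi]
      rw [this]
      exact Submodule.smul_mem _ _ (Submodule.sub_mem _ (hmem j) h0)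
  rw [eq_top_iff, ← (Pi.basisFun ℂ (Fin (n + 2))).span_eq, Submodule.span_le]
  rintro _ ⟨j, rfl⟩
  simpa using hj j

lemma fam_li (n : ℕ) : LinearIndependent ℂ (fam n) :=
  linearIndependent_of_top_le_span_of_card_eq_finrank (fam_span n).ge (by simp)

/-- Existence and dimension for all `r` with `1 ≤ r ≤ n + 1`. -/
lemma exists_family (n r : ℕ) (hn : 1 ≤ n) (hr : 1 ≤ r) (hrn : r ≤ n + 1) :
    ∃ ℓ : Fin r → (Fin (n + 1) → ℂ), (∀ j, ℓ j ≠ 0) ∧ (∀ j, Isotropic (ℓ j)) ∧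
      Module.finrank ℂ (TS ℓ) + 1 + r.choose 2 = r * (n + 1) := by
  obtain ⟨n, rfl⟩ : ∃ k, n = k + 1 := ⟨n - 1, by omega⟩
  obtain ⟨r, rfl⟩ : ∃ k, r = k + 1 := ⟨r - 1, by omega⟩
  have hli : LinearIndependent ℂ (fun j : Fin (r + 1) => fam n (Fin.castLE hrn j)) :=
    (fam_li n).comp _ (Fin.castLE_injective hrn)
  set ℓ : Fin (r + 1) → (Fin (n + 1 + 1) → ℂ) := fun j => fam n (Fin.castLE hrn j) with hℓ
  refine ⟨ℓ, fun j => hli.ne_zero j, fun j => fam_isotropic n _, ?_⟩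
  have hd : Module.finrank ℂ (Submodule.span ℂ (Set.range ℓ)) = r + 1 := by
    rw [finrank_span_eq_card hli, Fintype.card_fin]
  have hb : Submodule.span ℂ (Set.range ℓ) ≠ ⊥ := by
    intro h
    rw [h] at hd
    simp at hd
  have h1 := TS_upper ℓ hb
  have h2 := TS_lower ℓ 0 (hli.ne_zero 0) (fun j hj => by
    have : Fin.castLE hrn j ≠ 0 := by
      intro h
      apply hj
      apply Fin.castLE_injective hrn
      rw [h]
      rfl
    exact fam_pair n _ this)
  have h3 := LM_upper _ _ hd
  have h4 := LM_lower (n + 1 - r) (Submodule.span ℂ (Set.range ℓ)) (by omega)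
  rw [hd] at h4
  omega

lemma choose_two_pred (r : ℕ) (hr : 1 ≤ r) : r.choose 2 = (r - 1) + (r - 1).choose 2 := by
  obtain ⟨r, rfl⟩ : ∃ k, r = k + 1 := ⟨r - 1, by omega⟩
  rw [Nat.choose_succ_succ' r 1, Nat.choose_one_right, Nat.add_sub_cancel]

/-- Monotonicity of the expected dimension. -/
lemma mono_dim (n s k : ℕ) (h : s + k ≤ n) :
    s * (n + 1) + (s + k).choose 2 ≤ (s + k) * (n + 1) + s.choose 2 := by
  induction k with
  | zero => simp
  | succ k ih =>
    have h1 := ih (by omega)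
    have h2 := choose_two_pred (s + (k + 1)) (by omega)
    rw [show s + (k + 1) - 1 = s + k by omega] at h2
    have : (s + (k + 1)) * (n + 1) = (s + k) * (n + 1) + (n + 1) := by ring
    omega

lemma TS_bound (n r : ℕ) (hr : 1 ≤ r) (hrn : r ≤ n) (ℓ : Fin r → (Fin (n + 1) → ℂ)) :
    Module.finrank ℂ (TS ℓ) ≤ r * n - (r - 1).choose 2 := by
  by_cases hb : Submodule.span ℂ (Set.range ℓ) = ⊥
  · have h1 := Submodule.finrank_mono (TS_le ℓ)
    rw [hb] at h1
    have h2 := LM_upper (n := n + 1) 0 ⊥ (by simp)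
    omega
  have h1 := TS_upper ℓ hb
  have h2 := LM_upper _ (Submodule.span ℂ (Set.range ℓ)) rfl
  have hs : Module.finrank ℂ (Submodule.span ℂ (Set.range ℓ)) ≤ r := by
    have := finrank_range_le_card (R := ℂ) (b := ℓ)
    simpa [Set.finrank] using this
  generalize Module.finrank ℂ (Submodule.span ℂ (Set.range ℓ)) = s at hs h2
  have h3 := mono_dim n s (r - s) (by omega)
  rw [show s + (r - s) = r by omega] at h3
  have h4 := choose_two_pred r hr
  have h5 : r * (n + 1) = r * n + r := by ring
  omega

/-- Dimensions of the secant varieties of the variety of squares of isotropic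
linear forms (via Terracini): for `1 ≤ r ≤ n` the span of the tangent spaces
`ℓⱼ·(ℓⱼ)^⊥` has dimension exactly `r·n − C(r−1,2)` for some choice of
isotropic forms, and at most that for every choice; for `r = n + 1` the span
fills the space of harmonic quadratic forms, of dimension `C(n+2,2) − 1`. -/
theorem stmt19 (n : ℕ) (hn : 1 ≤ n) :
    (∀ r : ℕ, 1 ≤ r → r ≤ n →
      (∃ ℓ : Fin r → (Fin (n + 1) → ℂ),
        (∀ j, ℓ j ≠ 0) ∧ (∀ j, Isotropic (ℓ j)) ∧
        Module.finrank ℂ ↥(Submodule.span ℂ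
          {p : MvPolynomial (Fin (n + 1)) ℂ |
            ∃ (j : Fin r) (m : Fin (n + 1) → ℂ),
              (∑ i, ℓ j i * m i = 0) ∧ p = lin (ℓ j) * lin m}) =
        r * n - (r - 1).choose 2) ∧
      (∀ ℓ : Fin r → (Fin (n + 1) → ℂ), (∀ j, Isotropic (ℓ j)) →
        Module.finrank ℂ ↥(Submodule.span ℂ
          {p : MvPolynomial (Fin (n + 1)) ℂ |
            ∃ (j : Fin r) (m : Fin (n + 1) → ℂ),
              (∑ i, ℓ j i * m i = 0) ∧ p = lin (ℓ j) * lin m}) ≤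
        r * n - (r - 1).choose 2)) ∧
    (∃ ℓ : Fin (n + 1) → (Fin (n + 1) → ℂ),
      (∀ j, ℓ j ≠ 0) ∧ (∀ j, Isotropic (ℓ j)) ∧
      ((Submodule.span ℂ
          {p : MvPolynomial (Fin (n + 1)) ℂ |
            ∃ (j : Fin (n + 1)) (m : Fin (n + 1) → ℂ),
              (∑ i, ℓ j i * m i = 0) ∧ p = lin (ℓ j) * lin m} :
          Set (MvPolynomial (Fin (n + 1)) ℂ)) =
        {h : MvPolynomial (Fin (n + 1)) ℂ | lap h = 0 ∧ h.IsHomogeneous 2}) ∧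
      Module.finrank ℂ ↥(Submodule.span ℂ
          {p : MvPolynomial (Fin (n + 1)) ℂ |
            ∃ (j : Fin (n + 1)) (m : Fin (n + 1) → ℂ),
              (∑ i, ℓ j i * m i = 0) ∧ p = lin (ℓ j) * lin m}) =
        (n + 2).choose 2 - 1) := by
  refine ⟨fun r hr hrn => ⟨?_, fun ℓ _ => TS_bound n r hr hrn ℓ⟩, ?_⟩
  · obtain ⟨ℓ, h1, h2, h3⟩ := exists_family n r hn hr (by omega)
    refine ⟨ℓ, h1, h2, ?_⟩
    change Module.finrank ℂ (TS ℓ) = _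
    have h4 := choose_two_pred r hr
    have h5 : r * (n + 1) = r * n + r := by ring
    omega
  · obtain ⟨ℓ, h1, h2, h3⟩ := exists_family n (n + 1) hn (by omega) le_rfl
    have hL := LM_lower (n := n + 1) 0 ⊤ (by simp)
    have hU := LM_upper (n := n + 1) (n + 1) ⊤ (by simp)
    rw [LM_top] at hL hU
    simp only [finrank_top, Module.finrank_fin_fun] at hL
    have hc := finrank_hom2 (n + 1)
    have hfin : Module.finrank ℂ (TS ℓ) + 1 = (n + 2).choose 2 := by
      rw [show n + 2 = n + 1 + 1 from rfl]
      omega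
    refine ⟨ℓ, h1, h2, ?_, ?_⟩
    · change (TS ℓ : Set (MvPolynomial (Fin (n + 1)) ℂ)) = _
      have hne : (⊤ : Submodule ℂ (Fin (n + 1) → ℂ)) ≠ ⊥ := top_ne_bot
      have hk := LM_not_le_ker hne
      have hle : TS ℓ ≤ LM ⊤ ⊓ LinearMap.ker (lapL (n + 1)) := by
        refine le_inf ((TS_le ℓ).trans ?_) (TS_le_ker ℓ)
        rw [LM_le]
        exact fun a _ m => mem_LM Submodule.mem_top m
      have hlt : LM (⊤ : Submodule ℂ (Fin (n + 1) → ℂ)) ⊓ LinearMap.ker (lapL (n + 1)) < LM ⊤ :=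
        lt_of_le_of_ne inf_le_left fun h => hk (inf_eq_left.1 h)
      have hf := Submodule.finrank_lt_finrank_of_lt hlt
      rw [show Module.finrank ℂ (LM (⊤ : Submodule ℂ (Fin (n + 1) → ℂ))) = (n + 2).choose 2 by
        rw [LM_top, hc]] at hf
      have he := Submodule.eq_of_le_of_finrank_le hle (by omega)
      rw [he, LM_top]
      ext p
      simp [and_comm]
    · change Module.finrank ℂ (TS ℓ) = _
      omega
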